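/- Let u be a classical solution of the damped linear Kawahara system. Then for every T > 0 the following identity holds: −(T/2)·∫₀¹ u(x,0)² dx + (1/2)·∫₀ᵀ ∫₀¹ u(x,t)² dx dt + ((1 − α²)/2)·∫₀ᵀ (T − t)·(∂ₓ²u(0,t))² dt = 0. -/

import Mathlib

theorem kaw_dx (v : ℝ → ℝ → ℝ) (hv : ContDiff ℝ (⊤ : ℕ∞) (Function.uncurry v)) :
    ContDiff ℝ (⊤ : ℕ∞) (Function.uncurry fun x t => deriv (fun y => v y t) x) := by
  have h : (Function.uncurry fun x t => deriv (fun y => v y t) x)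
      = fun p => fderiv ℝ (Function.uncurry v) p (1, 0) := by
    funext p
    obtain ⟨x, t⟩ := p
    have h1 : HasDerivAt (fun y : ℝ => (y, t)) ((1 : ℝ), (0 : ℝ)) x :=
      (hasDerivAt_id x).prodMk (hasDerivAt_const x t)
    have h2 := ((hv.differentiable (by simp)) (x, t)).hasFDerivAt.comp_hasDerivAt x h1
    exact h2.deriv
  rw [h]
  exact (hv.fderiv_right (m := (⊤ : ℕ∞)) (by simp)).clm_apply contDiff_const

theorem kaw_dt (v : ℝ → ℝ → ℝ) (hv : ContDiff ℝ (⊤ : ℕ∞) (Function.uncurry v)) :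
    ContDiff ℝ (⊤ : ℕ∞) (Function.uncurry fun x t => deriv (v x) t) := by
  have h : (Function.uncurry fun x t => deriv (v x) t)
      = fun p => fderiv ℝ (Function.uncurry v) p (0, 1) := by
    funext p
    obtain ⟨x, t⟩ := p
    have h1 : HasDerivAt (fun y : ℝ => (x, y)) ((0 : ℝ), (1 : ℝ)) t :=
      (hasDerivAt_const t x).prodMk (hasDerivAt_id t)
    have h2 := ((hv.differentiable (by simp)) (x, t)).hasFDerivAt.comp_hasDerivAt t h1
    exact h2.deriv
  rw [h]
  exact (hv.fderiv_right (m := (⊤ : ℕ∞)) (by simp)).clm_apply contDiff_const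

theorem kaw_iter (v : ℝ → ℝ → ℝ) (hv : ContDiff ℝ (⊤ : ℕ∞) (Function.uncurry v)) (k : ℕ) :
    ContDiff ℝ (⊤ : ℕ∞) (Function.uncurry fun x t => iteratedDeriv k (fun y => v y t) x) := by
  induction k with
  | zero => simpa using hv
  | succ k ih =>
    simp only [iteratedDeriv_succ]
    exact kaw_dx (fun x t => iteratedDeriv k (fun y => v y t) x) ih

theorem kaw_slice (f : ℝ → ℝ) (hf : ContDiff ℝ (⊤ : ℕ∞) f) (k : ℕ) (x : ℝ) :
    HasDerivAt (iteratedDeriv k f) (iteratedDeriv (k + 1) f x) x := by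
  rw [iteratedDeriv_succ]
  exact ((hf.differentiable_iteratedDeriv k (by exact_mod_cast ENat.natCast_lt_top k)) x).hasDerivAt

/-- Space integration by parts at a fixed time. -/
theorem kaw_space (f : ℝ → ℝ) (hf : ContDiff ℝ (⊤ : ℕ∞) f) (a : ℝ)
    (h0 : f 0 = 0) (h1 : f 1 = 0) (h0' : deriv f 0 = 0) (h1' : deriv f 1 = 0)
    (h2 : iteratedDeriv 2 f 1 = a * iteratedDeriv 2 f 0) :
    ∫ x in (0:ℝ)..1, f x * (iteratedDeriv 5 f x - iteratedDeriv 3 f x)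
      = (a ^ 2 - 1) / 2 * (iteratedDeriv 2 f 0) ^ 2 := by
  have c : ∀ k, Continuous (iteratedDeriv k f) := fun k =>
    hf.continuous_iteratedDeriv k (by exact_mod_cast le_top)
  have d := kaw_slice f hf
  have d0 : ∀ x, HasDerivAt f (iteratedDeriv 1 f x) x := fun x => by simpa using d 0 x
  have key : ∀ x, HasDerivAt (fun x => f x * iteratedDeriv 4 f x
      - iteratedDeriv 1 f x * iteratedDeriv 3 f x + (iteratedDeriv 2 f x) ^ 2 / 2
      - f x * iteratedDeriv 2 f x + (iteratedDeriv 1 f x) ^ 2 / 2)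
      (f x * (iteratedDeriv 5 f x - iteratedDeriv 3 f x)) x := by
    intro x
    have := ((((((d0 x).mul (d 4 x)).sub ((d 1 x).mul (d 3 x))).add
      (((d 2 x).pow 2).div_const 2)).sub ((d0 x).mul (d 2 x))).add
      (((d 1 x).pow 2).div_const 2))
    refine this.congr_deriv ?_
    norm_num
    ring
  rw [intervalIntegral.integral_eq_sub_of_hasDerivAt (fun x _ => key x)
    ((hf.continuous.mul ((c 5).sub (c 3))).intervalIntegrable _ _)]
  simp only [iteratedDeriv_one, h0, h1, h0', h1', h2]
  ring

theorem kaw_t (v : ℝ → ℝ → ℝ) (hv : Continuous (Function.uncurry v)) (x : ℝ) :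
    Continuous fun t => v x t :=
  hv.comp (by fun_prop : Continuous fun t : ℝ => (x, t))

theorem kaw_x (v : ℝ → ℝ → ℝ) (hv : Continuous (Function.uncurry v)) (t : ℝ) :
    Continuous fun x => v x t :=
  hv.comp (by fun_prop : Continuous fun x : ℝ => (x, t))

/-- Multiplier identity `(T-t)u` for classical solutions of the damped
linear Kawahara system. -/
theorem kawahara_multiplier_identity (α : ℝ) (hα : |α| < 1) (u : ℝ → ℝ → ℝ)
    (hu : ContDiff ℝ (⊤ : ℕ∞) (Function.uncurry u))
    (hpde : ∀ x ∈ Set.Icc (0:ℝ) 1, ∀ t : ℝ,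
      deriv (u x) t + iteratedDeriv 3 (fun y => u y t) x
        - iteratedDeriv 5 (fun y => u y t) x = 0)
    (hbc0 : ∀ t : ℝ, u 0 t = 0) (hbc1 : ∀ t : ℝ, u 1 t = 0)
    (hbx0 : ∀ t : ℝ, deriv (fun y => u y t) 0 = 0)
    (hbx1 : ∀ t : ℝ, deriv (fun y => u y t) 1 = 0)
    (hbxx : ∀ t : ℝ, iteratedDeriv 2 (fun y => u y t) 1
      = α * iteratedDeriv 2 (fun y => u y t) 0) :
    ∀ T : ℝ, 0 < T →
      -(T/2) * (∫ x in (0:ℝ)..1, (u x 0)^2)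
        + (1/2) * (∫ t in (0:ℝ)..T, ∫ x in (0:ℝ)..1, (u x t)^2)
        + ((1 - α^2)/2) * (∫ t in (0:ℝ)..T,
            (T - t) * (iteratedDeriv 2 (fun y => u y t) 0)^2) = 0 := by
  intro T hT
  have hUc : Continuous (fun p : ℝ × ℝ => u p.1 p.2) := hu.continuous
  have hVc : Continuous (fun p : ℝ × ℝ => deriv (u p.1) p.2) := (kaw_dt u hu).continuous
  have hBc : Continuous (fun t : ℝ => iteratedDeriv 2 (fun y => u y t) 0) :=
    kaw_t (fun x t => iteratedDeriv 2 (fun y => u y t) x) (kaw_iter u hu 2).continuous 0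
  have hs : ∀ t, ContDiff ℝ (⊤ : ℕ∞) (fun y => u y t) := fun t =>
    hu.comp (by fun_prop : ContDiff ℝ (⊤ : ℕ∞) fun y : ℝ => (y, t))
  have ht : ∀ x, ContDiff ℝ (⊤ : ℕ∞) (u x) := fun x =>
    hu.comp (by fun_prop : ContDiff ℝ (⊤ : ℕ∞) fun t : ℝ => (x, t))
  have hVx : ∀ t, Continuous fun x => deriv (u x) t := fun t =>
    kaw_x (fun x t => deriv (u x) t) (kaw_dt u hu).continuous t
  have hVt : ∀ x, Continuous fun t => deriv (u x) t := fun x =>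
    kaw_t (fun x t => deriv (u x) t) (kaw_dt u hu).continuous x
  have space : ∀ t, ∫ x in (0:ℝ)..1, u x t * deriv (u x) t
      = (α ^ 2 - 1) / 2 * (iteratedDeriv 2 (fun y => u y t) 0) ^ 2 := by
    intro t
    rw [← kaw_space (fun y => u y t) (hs t) α (hbc0 t) (hbc1 t) (hbx0 t) (hbx1 t) (hbxx t)]
    apply intervalIntegral.integral_congr
    intro x hx
    rw [Set.uIcc_of_le zero_le_one] at hx
    have := hpde x hx t
    have e : deriv (u x) t = iteratedDeriv 5 (fun y => u y t) x
      - iteratedDeriv 3 (fun y => u y t) x := by linarith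
    simp only [e]
  have time : ∀ x, ∫ t in (0:ℝ)..T, ((T - t) * (u x t * deriv (u x) t) - (u x t) ^ 2 / 2)
      = -(T / 2) * (u x 0) ^ 2 := by
    intro x
    have key : ∀ t, HasDerivAt (fun t => (T - t) * ((u x t) ^ 2 / 2))
        ((T - t) * (u x t * deriv (u x) t) - (u x t) ^ 2 / 2) t := by
      intro t
      have d : HasDerivAt (u x) (deriv (u x) t) t :=
        ((ht x).differentiable (by simp) t).hasDerivAt
      refine (((hasDerivAt_id t).const_sub T).mul ((d.pow 2).div_const 2)).congr_deriv ?_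
      simp
      ring
    have c1 := (ht x).continuous
    have c2 := hVt x
    rw [intervalIntegral.integral_eq_sub_of_hasDerivAt (fun t _ => key t)
      (Continuous.intervalIntegrable (by fun_prop) _ _)]
    ring
  have swap : ∫ x in (0:ℝ)..1, ∫ t in (0:ℝ)..T,
        ((T - t) * (u x t * deriv (u x) t) - (u x t) ^ 2 / 2)
      = ∫ t in (0:ℝ)..T, ∫ x in (0:ℝ)..1,
        ((T - t) * (u x t * deriv (u x) t) - (u x t) ^ 2 / 2) := by
    simp only [intervalIntegral.integral_of_le hT.le, intervalIntegral.integral_of_le zero_le_one]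
    apply MeasureTheory.integral_integral_swap
    rw [MeasureTheory.Measure.prod_restrict]
    have hc : Continuous (Function.uncurry fun x t =>
        (T - t) * (u x t * deriv (u x) t) - (u x t) ^ 2 / 2) :=
      ((continuous_const.sub continuous_snd).mul (hUc.mul hVc)).sub ((hUc.pow 2).div_const 2)
    exact (hc.continuousOn.integrableOn_compact
      (isCompact_Icc.prod isCompact_Icc)).mono_set
      (Set.prod_mono Set.Ioc_subset_Icc_self Set.Ioc_subset_Icc_self)
  have inner : ∀ t, ∫ x in (0:ℝ)..1, ((T - t) * (u x t * deriv (u x) t) - (u x t) ^ 2 / 2)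
      = (α ^ 2 - 1) / 2 * ((T - t) * (iteratedDeriv 2 (fun y => u y t) 0) ^ 2)
        - 1 / 2 * ∫ x in (0:ℝ)..1, (u x t) ^ 2 := by
    intro t
    have c1 := (hs t).continuous
    have c2 := hVx t
    rw [intervalIntegral.integral_sub (Continuous.intervalIntegrable (by fun_prop) _ _)
      (Continuous.intervalIntegrable (by fun_prop) _ _),
      intervalIntegral.integral_const_mul, space, intervalIntegral.integral_div]
    ring
  have hE : Continuous fun t => ∫ x in (0:ℝ)..1, (u x t) ^ 2 := by
    apply intervalIntegral.continuous_parametric_intervalIntegral_of_continuous'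
    exact (hUc.comp continuous_swap).pow 2
  simp only [time, inner] at swap
  rw [intervalIntegral.integral_const_mul,
    intervalIntegral.integral_sub (Continuous.intervalIntegrable (by fun_prop) _ _)
      (Continuous.intervalIntegrable (by fun_prop) _ _),
    intervalIntegral.integral_const_mul, intervalIntegral.integral_const_mul] at swap
  rw [swap]
  ring
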